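/- arXiv:1712.06110 — 3 statements merged into one kernel-verified Lean document; each statement's English description precedes it below -/
import Mathlib

section
/- Let d ≥ 1, let X ⊆ ℝ^d be a nonempty open set, let w : X → ℂ be continuous, and let ψ : X → X be continuous. For the weighted composition operator C_{w,ψ} : C(X) → C(X), f ↦ w·(f∘ψ), the following are equivalent: (i) C_{w,ψ} is topologically weakly mixing on C(X); (ii) C_{w,ψ} is topologically transitive on C(X); (iii) w has no zeros, ψ is injective, and ψ is run-away. -/
/-- Topological transitivity. -/
def TopTransitive {E : Type*} [TopologicalSpace E] (T : E → E) : Prop :=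
  ∀ U V : Set E, IsOpen U → IsOpen V → U.Nonempty → V.Nonempty →
    ∃ m : ℕ, 1 ≤ m ∧ ((T^[m] '' U) ∩ V).Nonempty

/-- Topological weak mixing. -/
def TopWeaklyMixing {E : Type*} [TopologicalSpace E] (T : E → E) : Prop :=
  ∀ U₁ U₂ V₁ V₂ : Set E, IsOpen U₁ → IsOpen U₂ → IsOpen V₁ → IsOpen V₂ →
    U₁.Nonempty → U₂.Nonempty → V₁.Nonempty → V₂.Nonempty →
    ∃ m : ℕ, 1 ≤ m ∧ ((T^[m] '' U₁) ∩ V₁).Nonempty ∧ ((T^[m] '' U₂) ∩ V₂).Nonempty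

/-- The run-away property. -/
def RunAway {X : Type*} [TopologicalSpace X] (ψ : X → X) : Prop :=
  ∀ K : Set X, IsCompact K → ∃ m : ℕ, 1 ≤ m ∧ (ψ^[m] '' K) ∩ K = ∅

open Set Filter Topology Module

section GeneralPosition

variable {E F : Type*} [NormedAddCommGroup E] [NormedSpace ℝ E] [FiniteDimensional ℝ E]
  [NormedAddCommGroup F] [NormedSpace ℝ F] [FiniteDimensional ℝ F]

/-- A continuous map into a space of larger dimension can be perturbed off zero on compact sets. -/
theorem exists_ne_zero_norm_sub_lt (hEF : finrank ℝ E < finrank ℝ F) {K : Set E}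
    (hK : IsCompact K) (h : C(E, F)) {ε : ℝ} (hε : 0 < ε) :
    ∃ g : C(E, F), (∀ x ∈ K, ‖g x - h x‖ < ε) ∧ ∀ x, g x ≠ 0 := by
  obtain ⟨p, hp, hpK⟩ : ∃ p : C(E, F), ContDiff ℝ 1 p ∧ ∀ x ∈ K, ‖p x - h x‖ < ε / 2 := by
    have hopen : IsOpen {p : C(E, F) | MapsTo (p - h) K (Metric.ball 0 (ε / 2))} :=
      (ContinuousMap.isOpen_setOfPred_mapsTo hK Metric.isOpen_ball).preimage
        (continuous_id.sub continuous_const)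
    obtain ⟨p, hp, hpd⟩ := (ContinuousMap.dense_setOfPred_contDiff (E := E) (F := F)).exists_mem_open
      hopen ⟨h, fun x _ => by simpa using hε⟩
    exact ⟨p, hp.out.of_le (mod_cast le_top), fun x hx => by simpa using hpd hx⟩
  obtain ⟨c, hc, hcε⟩ := (hp.dense_compl_range_of_finrank_lt_finrank hEF).exists_mem_open
    (Metric.isOpen_ball (x := (0 : F)) (ε := ε / 2)) ⟨0, by simpa using hε⟩
  refine ⟨p - ContinuousMap.const E c, fun x hx => ?_, fun x hx => hc ⟨x, ?_⟩⟩
  · have h₁ := hpK x hx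
    have h₂ : ‖c‖ < ε / 2 := by simpa using hcε
    calc ‖(p - ContinuousMap.const E c) x - h x‖ = ‖(p x - h x) - c‖ := by
          simp only [ContinuousMap.sub_apply, ContinuousMap.const_apply]; congr 1; abel
      _ ≤ ‖p x - h x‖ + ‖c‖ := norm_sub_le _ _
      _ < ε := by linarith
  · simpa [sub_eq_zero] using hx

end GeneralPosition

section Separation

theorem injective_iterate_prod {X : Type*} {ψ : X → X} (hinj : Function.Injective ψ) {N : ℕ}
    {U : Set X} (hU : ∀ y ∈ U, ∀ z ∈ U, ∀ k : ℕ, 1 ≤ k → k ≤ N → ψ^[k] z ≠ y) :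
    Function.Injective fun p : U × Fin (N + 1) => ψ^[p.2] (p.1 : X) := by
  have key : ∀ (y z : U) (i j : ℕ), i < j → j ≤ N → ψ^[i] (y : X) ≠ ψ^[j] (z : X) := by
    intro y z i j hij hj h
    obtain ⟨k, rfl⟩ := Nat.exists_eq_add_of_lt hij
    rw [add_assoc, Function.iterate_add_apply] at h
    exact hU y y.2 z z.2 (k + 1) (by omega) (by omega) (hinj.iterate i h).symm
  rintro ⟨y, i⟩ ⟨z, j⟩ h
  have hij : i = j := by
    rcases lt_trichotomy i j with hlt | heq | hlt
    · exact absurd h (key y z i j hlt (by omega))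
    · exact heq
    · exact absurd h.symm (key z y j i hlt (by omega))
  subst hij
  exact Prod.ext (Subtype.ext (hinj.iterate _ h)) rfl

variable {X : Type*} [TopologicalSpace X]

theorem exists_isCompact_nhds_ne_iterate [T2Space X] [LocallyCompactSpace X] (ψ : C(X, X))
    (hper : ∀ x : X, ∀ m : ℕ, 1 ≤ m → ψ^[m] x ≠ x) (N : ℕ) (x : X) :
    ∃ U ∈ 𝓝 x, IsCompact U ∧
      ∀ y ∈ U, ∀ z ∈ U, ∀ k : ℕ, 1 ≤ k → k ≤ N → ψ^[k] z ≠ y := by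
  have hev : ∀ᶠ p : X × X in 𝓝 x ×ˢ 𝓝 x, ∀ k ∈ Finset.Icc 1 N, ψ^[k] p.2 ≠ p.1 := by
    rw [Filter.eventually_all_finset, ← nhds_prod_eq]
    intro k hk
    have hc : Continuous fun p : X × X => ψ^[k] p.2 :=
      ((map_continuous ψ).iterate k).comp continuous_snd
    exact (isOpen_ne_fun hc continuous_fst).mem_nhds (hper x k (Finset.mem_Icc.1 hk).1)
  obtain ⟨t, ht, hts⟩ := Filter.mem_prod_same_iff.1 hev
  obtain ⟨U, hU, hUt, hUc⟩ := local_compact_nhds ht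
  exact ⟨U, hU, hUc, fun y hy z hz k h₁ h₂ =>
    hts (mk_mem_prod (hUt hy) (hUt hz)) k (Finset.mem_Icc.2 ⟨h₁, h₂⟩)⟩

end Separation

section Perturbation

variable {E : Type*} [NormedAddCommGroup E] [NormedSpace ℝ E] [FiniteDimensional ℝ E] {X : Set E}

/-- On a compact set `U` whose first `finrank ℝ E + 1` images under `ψ` are disjoint, every real
function has a small perturbation that is not constant on orbit segments starting in `U`. -/
theorem exists_perturbation_ne_on (ψ : C(X, X)) (hinj : Function.Injective ψ) {U : Set X}
    (hUc : IsCompact U)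
    (hU : ∀ y ∈ U, ∀ z ∈ U, ∀ k : ℕ, 1 ≤ k → k ≤ finrank ℝ E + 1 → ψ^[k] z ≠ y)
    (u : C(X, ℝ)) {ε : ℝ} (hε : 0 < ε) :
    ∃ v : C(X, ℝ), (∀ z, |v z - u z| ≤ ε) ∧
      ∀ x ∈ U, ∃ j ≤ finrank ℝ E + 1, v (ψ^[j] x) ≠ v x := by
  have : CompactSpace U := isCompact_iff_compactSpace.1 hUc
  set N := finrank ℝ E + 1 with hN
  let h : C(U, Fin N → ℝ) :=
    ⟨fun x i => u (ψ^[(i : ℕ) + 1] x) - u x, continuous_pi fun i =>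
      ((map_continuous u).comp (((map_continuous ψ).iterate _).comp continuous_subtype_val)).sub
        ((map_continuous u).comp continuous_subtype_val)⟩
  have hemb : IsClosedEmbedding fun x : U => ((x : X) : E) :=
    (continuous_subtype_val.comp continuous_subtype_val).isClosedEmbedding
      (Subtype.val_injective.comp Subtype.val_injective)
  obtain ⟨H, hH⟩ := ContinuousMap.exists_extension' hemb h
  have hH' : ∀ x : U, H ((x : X) : E) = h x := fun x => congrFun hH x
  obtain ⟨G, hG, hG0⟩ := exists_ne_zero_norm_sub_lt (F := Fin N → ℝ) (by simp [hN])
    (isCompact_range hemb.continuous) H hε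
  let q : C(U × Fin (N + 1), ℝ) :=
    ⟨fun p => Fin.cases (motive := fun _ => ℝ) 0 (fun i => G ((p.1 : X) : E) i - h p.1 i) p.2, by
      rw [continuous_prod_of_discrete_right]
      intro j
      refine Fin.cases ?_ (fun i => ?_) j
      · exact continuous_const
      · exact ((continuous_apply i).comp ((map_continuous G).comp hemb.continuous)).sub
          ((continuous_apply i).comp (map_continuous h))⟩
  have hq : ∀ p, q p ∈ Icc (-ε) ε := by
    rintro ⟨x, j⟩
    refine Fin.cases ?_ (fun i => ?_) j
    · exact ⟨by simpa [q] using hε.le, by simpa [q] using hε.le⟩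
    · have h₁ := norm_le_pi_norm (G ((x : X) : E) - H ((x : X) : E)) i
      have h₂ := hG _ (mem_range_self x)
      rw [hH'] at h₁ h₂
      exact abs_le.1 ((h₁.trans h₂.le : |G ((x : X) : E) i - h x i| ≤ ε))
  have hcont : Continuous fun p : U × Fin (N + 1) => ψ^[p.2] (p.1 : X) := by
    rw [continuous_prod_of_discrete_right]
    exact fun j => ((map_continuous ψ).iterate j).comp continuous_subtype_val
  have hcl := hcont.isClosedEmbedding (injective_iterate_prod hinj hU)
  obtain ⟨p, hp, hpq⟩ := ContinuousMap.exists_extension_forall_mem_of_isClosedEmbedding q hq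
    ⟨0, by simpa using hε.le⟩ hcl
  have hp' : ∀ x : U, ∀ j : Fin (N + 1), p (ψ^[j] x) = q (x, j) := fun x j =>
    congrFun hpq (x, j)
  refine ⟨u + p, fun z => ?_, fun x hx => ?_⟩
  · simpa using abs_le.2 (hp z)
  · obtain ⟨i, hi⟩ := Function.ne_iff.1 (hG0 (x : E))
    refine ⟨i + 1, i.2, fun heq => hi ?_⟩
    have h₁ : p (ψ^[(i : ℕ) + 1] x) = G (x : E) i - (u (ψ^[(i : ℕ) + 1] x) - u x) :=
      hp' ⟨x, hx⟩ i.succ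
    have h₀ : p x = 0 := hp' ⟨x, hx⟩ 0
    simp only [ContinuousMap.add_apply, h₁, h₀] at heq
    simp only [Pi.zero_apply]
    linarith

theorem exists_pos_le_abs_sub {Y : Type*} [TopologicalSpace Y] (ψ : C(Y, Y)) (v : C(Y, ℝ)) {N : ℕ}
    {U : Set Y} (hUc : IsCompact U) (hv : ∀ x ∈ U, ∃ j ≤ N, v (ψ^[j] x) ≠ v x) :
    ∃ δ > 0, ∀ x ∈ U, ∃ j ≤ N, δ ≤ |v (ψ^[j] x) - v x| := by
  let S : Y → ℝ := fun x => ∑ j ∈ Finset.range (N + 1), |v (ψ^[j] x) - v x|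
  have hS : Continuous S := continuous_finsetSum _ fun j _ =>
    (((map_continuous v).comp ((map_continuous ψ).iterate j)).sub (map_continuous v)).abs
  have hpos : ∀ x ∈ U, 0 < S x := fun x hx => by
    obtain ⟨j, hj, hne⟩ := hv x hx
    exact Finset.sum_pos' (fun _ _ => abs_nonneg _)
      ⟨j, Finset.mem_range.2 (by omega), abs_pos.2 (sub_ne_zero.2 hne)⟩
  obtain ⟨c, hc, hcS⟩ := hUc.exists_forall_le' hS.continuousOn hpos
  refine ⟨c / (N + 1), by positivity, fun x hx => ?_⟩
  by_contra! hlt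
  have : S x < ∑ j ∈ Finset.range (N + 1), c / (N + 1) :=
    Finset.sum_lt_sum_of_nonempty (by simp) fun j hj =>
      hlt j (by have := Finset.mem_range.1 hj; omega)
  have hsum : ∑ j ∈ Finset.range (N + 1), c / ((N : ℝ) + 1) = c := by
    simp; field_simp
  linarith [hcS x hx]

/-- For an injective aperiodic map there is a real function that is uniformly nonconstant on orbit
segments of bounded length starting in a given compact set. -/
theorem exists_uniformly_nonconstant (hX : IsOpen X) (ψ : C(X, X)) (hinj : Function.Injective ψ)
    (hper : ∀ x : X, ∀ m : ℕ, 1 ≤ m → ψ^[m] x ≠ x) {K : Set X} (hK : IsCompact K) :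
    ∃ (N : ℕ) (v : C(X, ℝ)), ∃ δ > 0, ∀ x ∈ K, ∃ j ≤ N, δ ≤ |v (ψ^[j] x) - v x| := by
  have : LocallyCompactSpace X := hX.locallyCompactSpace
  set N := finrank ℝ E + 1
  suffices h : ∀ u : C(X, ℝ), ∀ ε > 0, ∃ v : C(X, ℝ), (∀ z, |v z - u z| ≤ ε) ∧
      ∃ δ > 0, ∀ x ∈ K, ∃ j ≤ N, δ ≤ |v (ψ^[j] x) - v x| by
    obtain ⟨v, -, hv⟩ := h 0 1 one_pos
    exact ⟨N, v, hv⟩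
  refine hK.induction_on (p := fun s => ∀ u : C(X, ℝ), ∀ ε > 0, ∃ v : C(X, ℝ),
    (∀ z, |v z - u z| ≤ ε) ∧ ∃ δ > 0, ∀ x ∈ s, ∃ j ≤ N, δ ≤ |v (ψ^[j] x) - v x|) ?_ ?_ ?_ ?_
  · exact fun u ε hε => ⟨u, fun z => by simpa using hε.le, 1, one_pos, by simp⟩
  · intro s t hst ht u ε hε
    obtain ⟨v, hv, δ, hδ, h⟩ := ht u ε hε
    exact ⟨v, hv, δ, hδ, fun x hx => h x (hst hx)⟩
  · intro s t hs ht u ε hε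
    obtain ⟨v, hv, δ, hδ, h⟩ := hs u (ε / 2) (half_pos hε)
    obtain ⟨v', hv', δ', hδ', h'⟩ := ht v (min (ε / 2) (δ / 4)) (by positivity)
    refine ⟨v', fun z => ?_, min (δ / 2) δ', by positivity, ?_⟩
    · have h₁ := (hv' z).trans (min_le_left _ _)
      linarith [abs_sub_le (v' z) (v z) (u z), hv z]
    · rintro x (hx | hx)
      · obtain ⟨j, hj, hle⟩ := h x hx
        refine ⟨j, hj, (min_le_left _ _).trans ?_⟩
        have h₁ := (hv' x).trans (min_le_right _ _)
        have h₂ := (hv' (ψ^[j] x)).trans (min_le_right _ _)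
        rw [abs_sub_comm] at h₂
        have h₃ := abs_sub_le (v (ψ^[j] x)) (v' (ψ^[j] x)) (v x)
        have h₄ := abs_sub_le (v' (ψ^[j] x)) (v' x) (v x)
        linarith
      · obtain ⟨j, hj, hle⟩ := h' x hx
        exact ⟨j, hj, (min_le_right _ _).trans hle⟩
  · intro x _
    obtain ⟨U, hU, hUc, hUψ⟩ := exists_isCompact_nhds_ne_iterate ψ hper N x
    refine ⟨U, mem_nhdsWithin_of_mem_nhds hU, fun u ε hε => ?_⟩
    obtain ⟨v, hv, hne⟩ := exists_perturbation_ne_on ψ hinj hUc hUψ u hε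
    exact ⟨v, hv, exists_pos_le_abs_sub ψ v hUc hne⟩

end Perturbation

section WeightedComposition

variable {X : Type*} [TopologicalSpace X]

/-- The weighted composition operator `f ↦ w·(f∘ψ)`. -/
noncomputable def weightedComp (w : C(X, ℂ)) (ψ : C(X, X)) (f : C(X, ℂ)) : C(X, ℂ) := w * f.comp ψ

/-- The product of the weight along the first `m` points of an orbit. -/
noncomputable def weightProd (w : C(X, ℂ)) (ψ : C(X, X)) (m : ℕ) (x : X) : ℂ :=
  ∏ i ∈ Finset.range m, w (ψ^[i] x)

variable {w : C(X, ℂ)} {ψ : C(X, X)}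

theorem continuous_weightProd (m : ℕ) : Continuous (weightProd w ψ m) :=
  continuous_finsetProd _ fun i _ => (map_continuous w).comp ((map_continuous ψ).iterate i)

theorem weightProd_ne_zero (hw : ∀ x, w x ≠ 0) (m : ℕ) (x : X) : weightProd w ψ m x ≠ 0 :=
  Finset.prod_ne_zero_iff.2 fun _ _ => hw _

theorem weightedComp_iterate_apply (m : ℕ) (f : C(X, ℂ)) (x : X) :
    (weightedComp w ψ)^[m] f x = weightProd w ψ m x * f (ψ^[m] x) := by
  induction m generalizing f with
  | zero => simp [weightProd]
  | succ m ih =>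
    rw [Function.iterate_succ_apply, ih, weightProd, weightProd, Finset.prod_range_succ,
      Function.iterate_succ_apply']
    simp [weightedComp, mul_assoc]

theorem exists_isCompact_eqOn_mem {U : Set C(X, ℂ)} (hU : IsOpen U) {f : C(X, ℂ)} (hf : f ∈ U) :
    ∃ K : Set X, IsCompact K ∧ ∀ g : C(X, ℂ), EqOn g f K → g ∈ U := by
  obtain ⟨⟨K, V⟩, ⟨hK, hV⟩, hsub⟩ := (nhds_basis_uniformity'
    ContinuousMap.hasBasis_compactConvergenceUniformity).mem_iff.1 (hU.mem_nhds hf)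
  refine ⟨K, hK, fun g hg => hsub ?_⟩
  intro x hx
  simpa [hg hx] using refl_mem_uniformity hV

theorem exists_eqOn_iterate_eqOn [T2Space X] [NormalSpace X] (hw : ∀ x, w x ≠ 0)
    (hinj : Function.Injective ψ) {K : Set X} (hK : IsCompact K) {m : ℕ}
    (hm : (ψ^[m] '' K) ∩ K = ∅) (f g : C(X, ℂ)) :
    ∃ h : C(X, ℂ), EqOn h f K ∧ EqOn ((weightedComp w ψ)^[m] h) g K := by
  have : CompactSpace K := isCompact_iff_compactSpace.1 hK
  let e : K ⊕ K → X := Sum.elim (fun x => x) (fun x => ψ^[m] x)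
  have he : Continuous e := continuous_subtype_val.sumElim
    (((map_continuous ψ).iterate m).comp continuous_subtype_val)
  have hdisj : ∀ x y : K, (x : X) ≠ ψ^[m] y := fun x y hxy =>
    (hm ▸ (⟨⟨y, y.2, hxy.symm⟩, x.2⟩ : (x : X) ∈ (ψ^[m] '' K) ∩ K) : (x : X) ∈ (∅ : Set X))
  have hei : Function.Injective e := Subtype.val_injective.sumElim
    ((hinj.iterate m).comp Subtype.val_injective) hdisj
  let q : C(K ⊕ K, ℂ) :=
    ⟨Sum.elim (fun x => f x) (fun x => (weightProd w ψ m x)⁻¹ * g x),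
      ((map_continuous f).comp continuous_subtype_val).sumElim
        ((((continuous_weightProd m).inv₀ (weightProd_ne_zero hw m)).mul
          (map_continuous g)).comp continuous_subtype_val)⟩
  obtain ⟨h, hh⟩ := ContinuousMap.exists_extension' (he.isClosedEmbedding hei) q
  refine ⟨h, fun x hx => congrFun hh (.inl ⟨x, hx⟩), fun x hx => ?_⟩
  have h₁ : h (ψ^[m] x) = (weightProd w ψ m x)⁻¹ * g x := congrFun hh (.inr ⟨x, hx⟩)
  rw [weightedComp_iterate_apply, h₁, mul_inv_cancel_left₀ (weightProd_ne_zero hw m x)]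

theorem topWeaklyMixing_weightedComp [T2Space X] [NormalSpace X] (hw : ∀ x, w x ≠ 0)
    (hinj : Function.Injective ψ) (hrun : RunAway ψ) : TopWeaklyMixing (weightedComp w ψ) := by
  rintro U₁ U₂ V₁ V₂ hU₁ hU₂ hV₁ hV₂ ⟨f₁, hf₁⟩ ⟨f₂, hf₂⟩ ⟨g₁, hg₁⟩ ⟨g₂, hg₂⟩
  obtain ⟨A₁, hA₁, hA₁U⟩ := exists_isCompact_eqOn_mem hU₁ hf₁
  obtain ⟨A₂, hA₂, hA₂U⟩ := exists_isCompact_eqOn_mem hU₂ hf₂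
  obtain ⟨B₁, hB₁, hB₁V⟩ := exists_isCompact_eqOn_mem hV₁ hg₁
  obtain ⟨B₂, hB₂, hB₂V⟩ := exists_isCompact_eqOn_mem hV₂ hg₂
  obtain ⟨m, hm, hdisj⟩ := hrun ((A₁ ∪ B₁) ∪ (A₂ ∪ B₂)) ((hA₁.union hB₁).union (hA₂.union hB₂))
  have key : ∀ {A B : Set X} {U V : Set C(X, ℂ)} {f g : C(X, ℂ)},
      A ∪ B ⊆ (A₁ ∪ B₁) ∪ (A₂ ∪ B₂) → (∀ h : C(X, ℂ), EqOn h f A → h ∈ U) →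
      (∀ h : C(X, ℂ), EqOn h g B → h ∈ V) →
      (((weightedComp w ψ)^[m] '' U) ∩ V).Nonempty := by
    intro A B U V f g hsub hU hV
    obtain ⟨h, hf, hg⟩ := exists_eqOn_iterate_eqOn hw hinj
      ((hA₁.union hB₁).union (hA₂.union hB₂)) hdisj f g
    exact ⟨_, mem_image_of_mem _ (hU h (hf.mono (subset_union_left.trans hsub))),
      hV _ (hg.mono (subset_union_right.trans hsub))⟩
  exact ⟨m, hm, key subset_union_left hA₁U hB₁V, key subset_union_right hA₂U hB₂V⟩

theorem TopWeaklyMixing.topTransitive {Y : Type*} [TopologicalSpace Y] {T : Y → Y}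
    (h : TopWeaklyMixing T) : TopTransitive T := fun U V hU hV hU' hV' =>
  let ⟨m, hm, hne, _⟩ := h U U V V hU hU hV hV hU' hU' hV' hV'
  ⟨m, hm, hne⟩

theorem TopTransitive.exists_iterate_mem {Y : Type*} [TopologicalSpace Y] {T : Y → Y}
    (h : TopTransitive T) {U V : Set Y} (hU : IsOpen U) (hV : IsOpen V) (hU' : U.Nonempty)
    (hV' : V.Nonempty) : ∃ m : ℕ, 1 ≤ m ∧ ∃ f ∈ U, T^[m] f ∈ V := by
  obtain ⟨m, hm, _, ⟨f, hf, rfl⟩, hV⟩ := h U V hU hV hU' hV'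
  exact ⟨m, hm, f, hf, hV⟩

theorem TopTransitive.weight_ne_zero (hT : TopTransitive (weightedComp w ψ)) (x : X) :
    w x ≠ 0 := by
  intro hx
  have hopen : IsOpen {f : C(X, ℂ) | f x ≠ 0} :=
    isOpen_ne_fun (continuous_eval_const x) continuous_const
  obtain ⟨m, hm, f, -, hf⟩ := hT.exists_iterate_mem isOpen_univ hopen univ_nonempty
    ⟨1, by simp⟩
  obtain ⟨m, rfl⟩ := Nat.exists_eq_add_of_le' hm
  exact hf (by simp [Function.iterate_succ_apply', weightedComp, hx])

theorem TopTransitive.injective [T2Space X] [NormalSpace X]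
    (hT : TopTransitive (weightedComp w ψ)) : Function.Injective ψ := by
  intro x y hxy
  by_contra hne
  have hopen : IsOpen {f : C(X, ℂ) | w y * f x ≠ w x * f y} :=
    isOpen_ne_fun (continuous_const.mul (continuous_eval_const x))
      (continuous_const.mul (continuous_eval_const y))
  obtain ⟨g, hgx, hgy, -⟩ := exists_continuous_zero_one_of_isClosed (isClosed_singleton (x := x))
    (isClosed_singleton (x := y)) (by simpa using hne)
  have hgx : g x = 0 := hgx rfl
  have hgy : g y = 1 := hgy rfl
  obtain ⟨m, hm, f, -, hf⟩ := hT.exists_iterate_mem isOpen_univ hopen univ_nonempty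
    ⟨⟨fun z => (g z : ℂ), by fun_prop⟩, by simpa [hgx, hgy] using (hT.weight_ne_zero x).symm⟩
  obtain ⟨m, rfl⟩ := Nat.exists_eq_add_of_le' hm
  apply hf
  simp only [Function.iterate_succ_apply', weightedComp, ContinuousMap.mul_apply,
    ContinuousMap.comp_apply, hxy]
  ring

theorem weightProd_add (m n : ℕ) (x : X) :
    weightProd w ψ (m + n) x = weightProd w ψ m x * weightProd w ψ n (ψ^[m] x) := by
  simp only [weightProd, Finset.prod_range_add, ← Function.iterate_add_apply, add_comm]

theorem weightProd_mul_of_isPeriodicPt {p : ℕ} {x : X} (hp : ψ^[p] x = x) (k : ℕ) :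
    weightProd w ψ (p * k) x = weightProd w ψ p x ^ k := by
  induction k with
  | zero => simp [weightProd]
  | succ k ih =>
    have : ψ^[p * k] x = x := (Function.IsPeriodicPt.mul_const (f := ψ) hp k)
    rw [mul_add, mul_one, weightProd_add, this, ih, pow_succ]

theorem norm_iterate_of_isPeriodicPt {p : ℕ} {x : X} (hp : ψ^[p] x = x) (m : ℕ) (f : C(X, ℂ)) :
    ‖(weightedComp w ψ)^[m] f x‖ =
      ‖weightProd w ψ p x‖ ^ (m / p) * (‖weightProd w ψ (m % p) x‖ * ‖f (ψ^[m % p] x)‖) := by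
  have h₁ : ψ^[p * (m / p)] x = x := (Function.IsPeriodicPt.mul_const (f := ψ) hp _)
  conv_lhs => rw [← Nat.div_add_mod m p]
  rw [weightedComp_iterate_apply, weightProd_add, h₁, weightProd_mul_of_isPeriodicPt hp,
    add_comm, Function.iterate_add_apply, h₁]
  simp [mul_assoc]

theorem isOpen_setOf_mapsTo_ball {K : Set X} (hK : IsCompact K) :
    IsOpen {f : C(X, ℂ) | MapsTo f K (Metric.ball 1 (1 / 2))} :=
  ContinuousMap.isOpen_setOfPred_mapsTo hK Metric.isOpen_ball

theorem norm_mem_Ioo_of_mem_ball {z : ℂ} (hz : z ∈ Metric.ball (1 : ℂ) (1 / 2)) :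
    ‖z‖ ∈ Ioo (1 / 2 : ℝ) (3 / 2) := by
  rw [mem_ball_iff_norm] at hz
  have h₁ := norm_sub_norm_le (1 : ℂ) z
  have h₂ := norm_sub_norm_le z (1 : ℂ)
  rw [norm_sub_rev] at h₁
  simp only [norm_one] at h₁ h₂
  constructor <;> linarith

theorem TopTransitive.iterate_ne (hT : TopTransitive (weightedComp w ψ)) (x : X) (p : ℕ)
    (hp : 1 ≤ p) : ψ^[p] x ≠ x := by
  intro hx
  let L : Set X := (fun r => ψ^[r] x) '' Finset.range p
  have hL : IsCompact L := ((Finset.finite_toSet _).image _).isCompact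
  have hmem : ∀ m : ℕ, ψ^[m % p] x ∈ L := fun m => 
    mem_image_of_mem _ (Finset.mem_coe.2 (Finset.mem_range.2 (Nat.mod_lt m hp)))
  have hne : {f : C(X, ℂ) | MapsTo f L (Metric.ball 1 (1 / 2))}.Nonempty := ⟨1, fun _ _ => by simp⟩
  have hcont : Continuous fun f : C(X, ℂ) => ‖f x‖ := (continuous_eval_const x).norm
  rcases le_total 1 ‖weightProd w ψ p x‖ with ha | ha
  · obtain ⟨c, hc, hcle⟩ : ∃ c > 0, ∀ r ∈ Finset.range p, c ≤ ‖weightProd w ψ r x‖ := by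
      obtain ⟨r, -, hr⟩ := (Finset.range p).exists_min_image (fun r => ‖weightProd w ψ r x‖)
        ⟨0, Finset.mem_range.2 hp⟩
      exact ⟨_, norm_pos_iff.2 (weightProd_ne_zero hT.weight_ne_zero r x), hr⟩
    obtain ⟨m, -, f, hf, hlt⟩ := hT.exists_iterate_mem (isOpen_setOf_mapsTo_ball hL)
      (isOpen_lt hcont (continuous_const (y := c / 2))) hne ⟨0, by simpa using hc⟩
    simp only [mem_ofPred_eq, norm_iterate_of_isPeriodicPt hx] at hlt
    have h₁ := hcle (m % p) (Finset.mem_range.2 (Nat.mod_lt m hp))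
    have h₂ := (norm_mem_Ioo_of_mem_ball (hf (hmem m))).1
    have h₃ := one_le_pow₀ ha (n := m / p)
    have h₄ : c * (1 / 2) ≤ ‖weightProd w ψ (m % p) x‖ * ‖f (ψ^[m % p] x)‖ := by gcongr
    nlinarith
  · obtain ⟨C, hCle⟩ : ∃ C, ∀ r ∈ Finset.range p, ‖weightProd w ψ r x‖ ≤ C := by
      obtain ⟨r, -, hr⟩ := (Finset.range p).exists_max_image (fun r => ‖weightProd w ψ r x‖)
        ⟨0, Finset.mem_range.2 hp⟩
      exact ⟨_, hr⟩
    have hC : 0 ≤ C := (norm_nonneg _).trans (hCle 0 (Finset.mem_range.2 hp))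
    obtain ⟨m, -, f, hf, hlt⟩ := hT.exists_iterate_mem (isOpen_setOf_mapsTo_ball hL)
      (isOpen_lt (continuous_const (y := C * (3 / 2))) hcont) hne
      ⟨ContinuousMap.const X ((C * (3 / 2) + 1 : ℝ) : ℂ), by
        simp only [mem_ofPred_eq, ContinuousMap.const_apply, Complex.norm_real, Real.norm_eq_abs]
        exact (lt_add_one _).trans_le (le_abs_self _)⟩
    simp only [mem_ofPred_eq, norm_iterate_of_isPeriodicPt hx] at hlt
    have h₁ := hCle (m % p) (Finset.mem_range.2 (Nat.mod_lt m hp))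
    have h₂ := (norm_mem_Ioo_of_mem_ball (hf (hmem m))).2
    have h₃ := pow_le_one₀ (n := m / p) (norm_nonneg _) ha
    have h₄ : ‖weightProd w ψ (m % p) x‖ * ‖f (ψ^[m % p] x)‖ ≤ C * (3 / 2) := by gcongr
    have h₅ := mul_le_of_le_one_left
      (mul_nonneg (norm_nonneg (weightProd w ψ (m % p) x)) (norm_nonneg (f (ψ^[m % p] x)))) h₃
    linarith

theorem exists_bound_weightProd (hw : ∀ x, w x ≠ 0) {K : Set X} (hK : IsCompact K) (N : ℕ) :
    ∃ M > 0, ∀ x ∈ K, ∀ j ≤ N, ‖weightProd w ψ j x‖ ≤ M ∧ M⁻¹ ≤ ‖weightProd w ψ j x‖ := by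
  let S : X → ℝ := fun x => ∑ j ∈ Finset.range (N + 1),
    (‖weightProd w ψ j x‖ + ‖weightProd w ψ j x‖⁻¹)
  have hS : Continuous S := continuous_finsetSum _ fun j _ =>
    (continuous_weightProd j).norm.add ((continuous_weightProd j).norm.inv₀
      fun x => norm_ne_zero_iff.2 (weightProd_ne_zero hw j x))
  obtain ⟨M, hM⟩ := hK.exists_bound_of_continuousOn hS.continuousOn
  refine ⟨max M 1, by positivity, fun x hx j hj => ?_⟩
  have hpos : 0 < ‖weightProd w ψ j x‖ := norm_pos_iff.2 (weightProd_ne_zero hw j x)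
  have h₁ : ‖weightProd w ψ j x‖ + ‖weightProd w ψ j x‖⁻¹ ≤ S x :=
    Finset.single_le_sum (f := fun j => ‖weightProd w ψ j x‖ + ‖weightProd w ψ j x‖⁻¹)
      (fun i _ => by positivity) (Finset.mem_range.2 (by omega))
  have h₂ : S x ≤ max M 1 := ((le_abs_self _).trans (hM x hx)).trans (le_max_left _ _)
  have h₃ : 0 < ‖weightProd w ψ j x‖⁻¹ := by positivity
  exact ⟨by linarith, inv_le_of_inv_le₀ hpos (by linarith)⟩

theorem mul_exp_ne_of_bounds {M A B a b p q : ℝ} (hM : 0 < M) (hA : M⁻¹ ≤ A) (hB : B ≤ M)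
    (hp : 1 / 4 < p) (hq₀ : 0 ≤ q) (hq : q < 9 / 4) (hab : 9 * M ^ 2 ≤ a - b) :
    A * Real.exp a * p ≠ B * Real.exp b * q := by
  have h₁ : Real.exp a = Real.exp (a - b) * Real.exp b := by rw [← Real.exp_add]; simp
  have h₂ : 9 * M ^ 2 + 1 ≤ Real.exp (a - b) := by linarith [Real.add_one_le_exp (a - b)]
  have hb := Real.exp_pos b
  have hlow : M⁻¹ * ((9 * M ^ 2) * Real.exp b) * (1 / 4) < A * Real.exp a * p := by
    have hA' : 0 < A := (inv_pos.2 hM).trans_le hA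
    rw [h₁]
    have : (9 * M ^ 2) ≤ Real.exp (a - b) := by linarith
    calc _ ≤ A * (Real.exp (a - b) * Real.exp b) * (1 / 4) := by gcongr
      _ < _ := by gcongr
  have hup : B * Real.exp b * q ≤ M * Real.exp b * (9 / 4) := by gcongr
  have heq : M⁻¹ * ((9 * M ^ 2) * Real.exp b) * (1 / 4) = M * Real.exp b * (9 / 4) := by
    field_simp
  linarith

/-- Since the operator commutes with its iterates, the values along the orbits of `x` and `ψ^[m] x`
are linked. -/
theorem weightProd_mul_iterate_eq (m j : ℕ) (f : C(X, ℂ)) (x : X) :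
    weightProd w ψ j x * (weightedComp w ψ)^[m] f (ψ^[j] x) * f (ψ^[m] x) =
      weightProd w ψ j (ψ^[m] x) * (weightedComp w ψ)^[m] f x * f (ψ^[j] (ψ^[m] x)) := by
  have h := congrArg (weightProd w ψ · x) (add_comm j m)
  simp only [weightProd_add] at h
  rw [weightedComp_iterate_apply, weightedComp_iterate_apply, ← mul_assoc, h,
    ← Function.iterate_add_apply, ← Function.iterate_add_apply, add_comm m j]
  ring

theorem TopTransitive.exists_iterate_image_inter_eq_empty [LocallyCompactSpace X]
    (hT : TopTransitive (weightedComp w ψ)) {K : Set X} (hK : IsCompact K) {N : ℕ} {u : C(X, ℝ)}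
    {δ : ℝ} (hδ : 0 < δ) (hu : ∀ x ∈ K, ∃ j ≤ N, δ ≤ |u (ψ^[j] x) - u x|) :
    ∃ m : ℕ, 1 ≤ m ∧ (ψ^[m] '' K) ∩ K = ∅ := by
  obtain ⟨M, hM, hMK⟩ := exists_bound_weightProd (ψ := ψ) hT.weight_ne_zero hK N
  let L : Set X := ⋃ j ∈ Finset.range (N + 1), ψ^[j] '' K
  have hL : IsCompact L := (Finset.range (N + 1)).isCompact_biUnion fun j _ =>
    hK.image ((map_continuous ψ).iterate j)
  have hLmem : ∀ x ∈ K, ∀ j ≤ N, ψ^[j] x ∈ L := fun x hx j hj =>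
    mem_biUnion (Finset.mem_coe.2 (Finset.mem_range.2 (by omega))) (mem_image_of_mem _ hx)
  let S : ℝ := 9 * M ^ 2 / δ
  let e : C(X, ℂ) := ⟨fun x => (Real.exp (-(S * u x)) : ℂ), by fun_prop⟩
  let e' : C(X, ℂ) := ⟨fun x => (Real.exp (S * u x) : ℂ), by fun_prop⟩
  have hee : e * e' = 1 := by
    ext x
    simp only [e, e', ContinuousMap.mul_apply, ContinuousMap.coe_mk, ContinuousMap.one_apply,
      ← Complex.ofReal_mul, ← Real.exp_add]
    simp
  obtain ⟨m, hm, f, hf, hg⟩ := hT.exists_iterate_mem (isOpen_setOf_mapsTo_ball hL)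
    ((isOpen_setOf_mapsTo_ball hL).preimage (continuous_const_mul e))
    ⟨1, fun _ _ => by simp⟩ ⟨e', fun _ _ => by simp [hee]⟩
  refine ⟨m, hm, eq_empty_of_forall_notMem ?_⟩
  rintro _ ⟨⟨x, hx, rfl⟩, hy⟩
  obtain ⟨j, hj, hle⟩ := hu x hx
  set g := (weightedComp w ψ)^[m] f with hgdef
  have hgnorm : ∀ z, ‖g z‖ = Real.exp (S * u z) * ‖(e * g) z‖ := fun z => by
    rw [ContinuousMap.mul_apply, norm_mul, ← mul_assoc]
    simp only [e, ContinuousMap.coe_mk, Complex.norm_real, Real.norm_eq_abs, Real.abs_exp,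
      ← Real.exp_add]
    simp
  have heq := congrArg norm (weightProd_mul_iterate_eq (w := w) (ψ := ψ) m j f x)
  simp only [norm_mul, ← hgdef, hgnorm] at heq
  have hfL := fun z (hz : z ∈ L) => norm_mem_Ioo_of_mem_ball (hf hz)
  have hgL := fun z (hz : z ∈ L) => norm_mem_Ioo_of_mem_ball (hg hz)
  have f₁ := hfL _ (hLmem _ hy 0 (Nat.zero_le _))
  have f₂ := hfL _ (hLmem _ hy j hj)
  have g₁ := hgL _ (hLmem _ hx 0 (Nat.zero_le _))
  have g₂ := hgL _ (hLmem _ hx j hj)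
  simp only [Function.iterate_zero, id_eq] at f₁ g₁
  have hprod : ∀ {s t : ℝ}, s ∈ Ioo (1 / 2 : ℝ) (3 / 2) → t ∈ Ioo (1 / 2 : ℝ) (3 / 2) →
      1 / 4 < s * t ∧ s * t < 9 / 4 := fun hs ht =>
    ⟨by nlinarith [hs.1, ht.1], by nlinarith [hs.1, hs.2, ht.1, ht.2]⟩
  have p₁ := hprod g₂ f₁
  have p₂ := hprod g₁ f₂
  have hS : S * δ = 9 * M ^ 2 := by simp only [S]; field_simp
  have hS₀ : 0 ≤ S := by simp only [S]; positivity
  have b₁ := hMK x hx j hj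
  have b₂ := hMK _ hy j hj
  rcases le_abs.1 hle with h | h
  · refine mul_exp_ne_of_bounds hM b₁.2 b₂.1 p₁.1 (by linarith) p₂.2 (a := S * u (ψ^[j] x))
      (b := S * u x) ?_ (by linear_combination heq)
    have := mul_le_mul_of_nonneg_left h hS₀
    linarith
  · refine mul_exp_ne_of_bounds hM b₂.2 b₁.1 p₂.1 (by linarith) p₁.2 (a := S * u x)
      (b := S * u (ψ^[j] x)) ?_ (by linear_combination -heq)
    have := mul_le_mul_of_nonneg_left h hS₀
    linarith

end WeightedComposition

/-- for `X ⊆ ℝ^d` open and nonempty, `w : X → ℂ` and `ψ : X → X` continuous,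
the weighted composition operator `f ↦ w·(f∘ψ)` on `C(X, ℂ)` is weakly mixing iff it is
transitive iff `w` has no zeros, `ψ` is injective and run-away. -/
theorem stmt6 (d : ℕ) (hd : 1 ≤ d)
    (X : Set (EuclideanSpace ℝ (Fin d))) (hXopen : IsOpen X) (hXne : X.Nonempty)
    (w : C(↥X, ℂ)) (ψ : C(↥X, ↥X)) :
    (TopWeaklyMixing (fun f : C(↥X, ℂ) => w * f.comp ψ) ↔
      TopTransitive (fun f : C(↥X, ℂ) => w * f.comp ψ)) ∧
    (TopTransitive (fun f : C(↥X, ℂ) => w * f.comp ψ) ↔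
      ((∀ x : ↥X, w x ≠ 0) ∧ Function.Injective ψ ∧ RunAway ⇑ψ)) := by
  have : LocallyCompactSpace X := hXopen.locallyCompactSpace
  have hrun (hT : TopTransitive (weightedComp w ψ)) : RunAway ψ := fun K hK =>
    let ⟨_, _, _, hδ, hu⟩ := exists_uniformly_nonconstant hXopen ψ hT.injective hT.iterate_ne hK
    hT.exists_iterate_image_inter_eq_empty hK hδ hu
  have hmix (hT : TopTransitive (weightedComp w ψ)) : TopWeaklyMixing (weightedComp w ψ) :=
    topWeaklyMixing_weightedComp hT.weight_ne_zero hT.injective (hrun hT)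
  exact ⟨⟨TopWeaklyMixing.topTransitive, hmix⟩,
    fun hT => ⟨TopTransitive.weight_ne_zero hT, TopTransitive.injective hT, hrun hT⟩,
    fun h => (topWeaklyMixing_weightedComp h.1 h.2.1 h.2.2).topTransitive⟩
end

section
/- Let d ≥ 1, let X ⊆ ℝ^d be a nonempty open set, let w : X → ℂ be continuous, and let ψ : X → X be continuous. For the weighted composition operator C_{w,ψ} : C(X) → C(X), f ↦ w·(f∘ψ), the following are equivalent: (i) C_{w,ψ} is topologically mixing on C(X); (ii) w has no zeros, ψ is injective, and ψ is strong run-away. -/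
/-- Topological mixing. -/
def TopMixing {E : Type*} [TopologicalSpace E] (T : E → E) : Prop :=
  ∀ U V : Set E, IsOpen U → IsOpen V → U.Nonempty → V.Nonempty →
    ∃ M : ℕ, ∀ m : ℕ, M ≤ m → ((T^[m] '' U) ∩ V).Nonempty

/-- The strong run-away property. -/
def StrongRunAway {X : Type*} [TopologicalSpace X] (ψ : X → X) : Prop :=
  ∀ K : Set X, IsCompact K → ∃ M : ℕ, ∀ m : ℕ, M ≤ m → (ψ^[m] '' K) ∩ K = ∅

/-- Membership in an open set of the compact-open topology only depends on the values of a function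
on some compact set. -/
theorem ContinuousMap.exists_isCompact_forall_eqOn_mem {X Y : Type*} [TopologicalSpace X]
    [TopologicalSpace Y] {U : Set C(X, Y)} (hU : IsOpen U) {f : C(X, Y)} (hf : f ∈ U) :
    ∃ K : Set X, IsCompact K ∧ ∀ g : C(X, Y), Set.EqOn g f K → g ∈ U := by
  induction hU with
  | basic s hs =>
    obtain ⟨K, hK, O, -, rfl⟩ := hs
    exact ⟨K, hK, fun g hg x hx => by simpa only [hg hx] using hf hx⟩
  | univ => exact ⟨∅, isCompact_empty, fun _ _ => Set.mem_univ _⟩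
  | inter s t _ _ ihs iht =>
    obtain ⟨K, hK, h⟩ := ihs hf.1
    obtain ⟨L, hL, h'⟩ := iht hf.2
    exact ⟨K ∪ L, hK.union hL, fun g hg =>
      ⟨h g (hg.mono Set.subset_union_left), h' g (hg.mono Set.subset_union_right)⟩⟩
  | sUnion S _ ih =>
    obtain ⟨s, hs, hfs⟩ := hf
    obtain ⟨K, hK, h⟩ := ih s hs hfs
    exact ⟨K, hK, fun g hg => ⟨s, hs, h g hg⟩⟩

/-- The iterates of a weighted composition operator are weighted composition operators. -/
theorem exists_iterate_weightedComp_apply {X : Type*} [TopologicalSpace X] (w : C(X, ℂ))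
    (ψ : C(X, X)) (m : ℕ) :
    ∃ W : C(X, ℂ), ((∀ x, w x ≠ 0) → ∀ x, W x ≠ 0) ∧
      ∀ f x, ((fun f : C(X, ℂ) => w * f.comp ψ)^[m] f) x = W x * f (ψ^[m] x) := by
  induction m with
  | zero => exact ⟨1, by simp, by simp⟩
  | succ m ih =>
    obtain ⟨W, hW, h⟩ := ih
    refine ⟨w * W.comp ψ, fun hw x => mul_ne_zero (hw x) (hW hw (ψ x)), fun f x => ?_⟩
    rw [Function.iterate_succ_apply', Function.iterate_succ_apply]
    simp only [ContinuousMap.mul_apply, ContinuousMap.comp_apply, h, mul_assoc]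

/-- Iterates of an injective continuous map that move a compact set off itself allow one to
prescribe a continuous function both on the set and, through the iterate, on its image. -/
theorem exists_continuousMap_eqOn_and_comp_eqOn {X : Type*} [TopologicalSpace X] [T2Space X]
    [NormalSpace X] {K : Set X} (hK : IsCompact K) {φ : X → X} (hφ : Continuous φ)
    (hinj : Function.Injective φ) (hdisj : φ '' K ∩ K = ∅) (f : C(X, ℂ)) {g : X → ℂ}
    (hg : Continuous g) :
    ∃ h : C(X, ℂ), Set.EqOn h f K ∧ Set.EqOn (h ∘ φ) g K := by
  have : CompactSpace K := isCompact_iff_compactSpace.mp hK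
  let e : K ⊕ K → X := Sum.elim Subtype.val fun x => φ x
  have hne (x y : K) : φ y ≠ x := fun h =>
    (Set.eq_empty_iff_forall_notMem.mp hdisj x) ⟨⟨y, y.2, h⟩, x.2⟩
  have he : Topology.IsClosedEmbedding e := by
    refine Continuous.isClosedEmbedding (by fun_prop) ?_
    exact Subtype.val_injective.sumElim (hinj.comp Subtype.val_injective)
      fun x y h => hne x y h.symm
  let k : C(K ⊕ K, ℂ) := ⟨Sum.elim (fun x => f x) fun x => g x, by fun_prop⟩
  obtain ⟨h, hh⟩ := ContinuousMap.exists_extension he k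
  exact ⟨h, fun x hx => by
    simpa [e, k] using DFunLike.congr_fun hh (Sum.inl ⟨x, hx⟩),
    fun x hx => by simpa [e, k] using DFunLike.congr_fun hh (Sum.inr ⟨x, hx⟩)⟩

theorem topMixing_weightedComp {X : Type*} [TopologicalSpace X] [T2Space X] [NormalSpace X]
    {w : C(X, ℂ)} {ψ : C(X, X)} (hw : ∀ x, w x ≠ 0) (hinj : Function.Injective ψ)
    (hrun : StrongRunAway ψ) : TopMixing (fun f : C(X, ℂ) => w * f.comp ψ) := by
  rintro U V hU hV ⟨f, hf⟩ ⟨g, hg⟩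
  obtain ⟨K, hK, hKU⟩ := ContinuousMap.exists_isCompact_forall_eqOn_mem hU hf
  obtain ⟨L, hL, hLV⟩ := ContinuousMap.exists_isCompact_forall_eqOn_mem hV hg
  obtain ⟨M, hM⟩ := hrun (K ∪ L) (hK.union hL)
  refine ⟨M, fun m hm => ?_⟩
  obtain ⟨W, hW, hT⟩ := exists_iterate_weightedComp_apply w ψ m
  obtain ⟨h, hhf, hhg⟩ := exists_continuousMap_eqOn_and_comp_eqOn (hK.union hL)
    (ψ.continuous.iterate m) (hinj.iterate m) (hM m hm) f
    (g.continuous.div W.continuous (hW hw))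
  refine ⟨_, ⟨h, hKU h (hhf.mono Set.subset_union_left), rfl⟩, hLV _ fun x hx => ?_⟩
  have hx' : h (ψ^[m] x) = g x / W x := hhg (Or.inr hx)
  rw [hT, hx', mul_div_cancel₀ _ (hW hw x)]

theorem TopMixing.weight_ne_zero {X : Type*} [TopologicalSpace X] {w : C(X, ℂ)} {ψ : C(X, X)}
    (h : TopMixing (fun f : C(X, ℂ) => w * f.comp ψ)) (x : X) : w x ≠ 0 := by
  intro hx
  obtain ⟨M, hM⟩ := h Set.univ {g | g x ≠ 0} isOpen_univ
    (isOpen_ne_fun (by fun_prop) continuous_const) Set.univ_nonempty ⟨1, by simp⟩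
  obtain ⟨-, ⟨f, -, rfl⟩, hf⟩ := hM (M + 1) (Nat.le_succ M)
  rw [Function.iterate_succ_apply'] at hf
  exact hf (by simp [hx])

theorem TopMixing.injective_symbol {X : Type*} [TopologicalSpace X] [T2Space X] [NormalSpace X]
    {w : C(X, ℂ)} {ψ : C(X, X)} (h : TopMixing (fun f : C(X, ℂ) => w * f.comp ψ)) :
    Function.Injective ψ := by
  intro x y hxy
  by_contra hne
  obtain ⟨p, hpx, hpy, -⟩ := exists_continuous_zero_one_of_isClosed
    (isClosed_singleton (x := x)) (isClosed_singleton (x := y))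
    (Set.disjoint_singleton.mpr hne)
  obtain ⟨M, hM⟩ := h Set.univ {g | w y * g x ≠ w x * g y} isOpen_univ
    (isOpen_ne_fun (by fun_prop) (by fun_prop)) Set.univ_nonempty
    ⟨⟨fun z => (p z : ℂ), by fun_prop⟩, by
      simp [hpx (Set.mem_singleton x), hpy (Set.mem_singleton y), (h.weight_ne_zero x).symm]⟩
  obtain ⟨-, ⟨f, -, rfl⟩, hf⟩ := hM (M + 1) (Nat.le_succ M)
  rw [Function.iterate_succ_apply'] at hf
  refine hf ?_
  simp only [ContinuousMap.mul_apply, ContinuousMap.comp_apply, hxy]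
  ring

theorem TopMixing.strongRunAway_symbol {X : Type*} [TopologicalSpace X] {w : C(X, ℂ)}
    {ψ : C(X, X)} (h : TopMixing (fun f : C(X, ℂ) => w * f.comp ψ)) : StrongRunAway ψ := by
  intro K hK
  have hopen {O : Set ℂ} (hO : IsOpen O) : IsOpen {f : C(X, ℂ) | Set.MapsTo f K O} :=
    ContinuousMap.isOpen_setOfPred_mapsTo hK hO
  have hA : IsOpen {z : ℂ | 1 < ‖z‖ ∧ ‖z‖ < 3} :=
    (isOpen_lt continuous_const continuous_norm).inter (isOpen_lt continuous_norm continuous_const)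
  have hB : IsOpen {z : ℂ | ‖z‖ < 1} := isOpen_lt continuous_norm continuous_const
  have hC : IsOpen {z : ℂ | 3 < ‖z‖} := isOpen_lt continuous_const continuous_norm
  have hAne : {f : C(X, ℂ) | Set.MapsTo f K {z : ℂ | 1 < ‖z‖ ∧ ‖z‖ < 3}}.Nonempty :=
    ⟨.const X 2, fun _ _ => by norm_num⟩
  obtain ⟨M, hM⟩ := h _ _ (hopen hA) (hopen hB) hAne ⟨.const X 0, fun _ _ => by norm_num⟩
  obtain ⟨N, hN⟩ := h _ _ (hopen hA) (hopen hC) hAne ⟨.const X 4, fun _ _ => by norm_num⟩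
  refine ⟨max M N, fun m hm => Set.eq_empty_iff_forall_notMem.mpr ?_⟩
  rintro - ⟨⟨x, hx, rfl⟩, hψx⟩
  obtain ⟨W, -, hT⟩ := exists_iterate_weightedComp_apply w ψ m
  obtain ⟨-, ⟨f, hf, rfl⟩, hfB⟩ := hM m ((le_max_left _ _).trans hm)
  obtain ⟨-, ⟨g, hg, rfl⟩, hgC⟩ := hN m ((le_max_right _ _).trans hm)
  have hf1 : 1 < ‖f (ψ^[m] x)‖ := (hf hψx).1
  have hg3 : ‖g (ψ^[m] x)‖ < 3 := (hg hψx).2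
  have hWf : ‖_‖ < (1 : ℝ) := hfB hx
  have hWg : (3 : ℝ) < ‖_‖ := hgC hx
  rw [hT, norm_mul] at hWf hWg
  nlinarith [norm_nonneg (W x), norm_nonneg (g (ψ^[m] x))]

/-- for `X ⊆ ℝ^d` open and nonempty, `w : X → ℂ` and `ψ : X → X` continuous,
the weighted composition operator `f ↦ w·(f∘ψ)` on `C(X, ℂ)` is topologically mixing iff
`w` has no zeros, `ψ` is injective and strong run-away. -/
theorem stmt7 (d : ℕ) (hd : 1 ≤ d)
    (X : Set (EuclideanSpace ℝ (Fin d))) (hXopen : IsOpen X) (hXne : X.Nonempty)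
    (w : C(↥X, ℂ)) (ψ : C(↥X, ↥X)) :
    TopMixing (fun f : C(↥X, ℂ) => w * f.comp ψ) ↔
      ((∀ x : ↥X, w x ≠ 0) ∧ Function.Injective ψ ∧ StrongRunAway ⇑ψ) := by
  exact ⟨fun h => ⟨h.weight_ne_zero, h.injective_symbol, h.strongRunAway_symbol⟩,
    fun ⟨hw, hinj, hrun⟩ => topMixing_weightedComp hw hinj hrun⟩
end

section
/- Let d ≥ 2, let ψ : ℝ^d → ℝ^d be continuous and injective, and let n ∈ ℕ with n ≥ 1 be such that ψ(B[0,n]) ∩ B[0,n] = ∅. Then ℝ^d \ (ψ(B(0,n)) ∪ B(0,n)) is a connected subset of ℝ^d. -/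
section NoRetraction

open Metric Set MeasureTheory Polynomial

variable {E : Type*} [NormedAddCommGroup E] [InnerProductSpace ℝ E] [FiniteDimensional ℝ E]

theorem det_one_add_eq_sum_lagrange (A : E →L[ℝ] E) (v : ℕ → ℝ)
    (hv : Set.InjOn v (Finset.range (Module.finrank ℝ E + 1))) :
    (1 + A).det = ∑ i ∈ Finset.range (Module.finrank ℝ E + 1),
      (Lagrange.basis (Finset.range (Module.finrank ℝ E + 1)) v i).eval 1 *
        (1 + v i • A).det := by
  set s := Finset.range (Module.finrank ℝ E + 1)
  let b := Module.finBasis ℝ E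
  let M := LinearMap.toMatrix b b (A : E →ₗ[ℝ] E)
  let p : ℝ[X] := Matrix.det ((X : ℝ[X]) • M.map C + (1 : Matrix _ _ ℝ).map C)
  have hp (t : ℝ) : p.eval t = (1 + t • A).det := by
    have h1 : (1 + t • A).det = (t • M + 1).det := by
      rw [ContinuousLinearMap.det, ← LinearMap.det_toMatrix b]
      congr 1
      simp [M, LinearMap.toMatrix_one, add_comm]
    rw [h1, ← Polynomial.coe_evalRingHom, RingHom.map_det]
    congr 1
    ext i j
    rcases eq_or_ne i j with rfl | hij
    · simp [mul_comm t]
    · simp [hij, mul_comm t]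
  have hdeg : p.degree < s.card := by
    rw [Finset.card_range]
    refine lt_of_le_of_lt Polynomial.degree_le_natDegree ?_
    have := natDegree_det_X_add_C_le M (1 : Matrix _ _ ℝ)
    rw [Fintype.card_fin] at this
    exact_mod_cast Nat.lt_succ_of_le this
  have key := congrArg (Polynomial.eval 1)
    (Lagrange.eq_interpolate (s := s) (v := v) hv hdeg)
  rw [hp, Lagrange.interpolate_apply, Polynomial.eval_finsetSum, one_smul] at key
  simpa [hp, mul_comm] using key

omit [FiniteDimensional ℝ E] in
theorem lipschitzWith_indicator_ball {h : E → E} {R : ℝ} {K : NNReal}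
    (hK : LipschitzOnWith K h (closedBall 0 R)) (h0 : ∀ x, ‖x‖ = R → h x = 0) :
    LipschitzWith K ((ball 0 R).indicator h) := by
  have eq_on : ∀ x ∈ closedBall (0 : E) R, (ball 0 R).indicator h x = h x := by
    intro x hx
    by_cases hx' : x ∈ ball (0 : E) R
    · exact indicator_of_mem hx' h
    · rw [indicator_of_notMem hx', h0]
      simp only [mem_closedBall, mem_ball, dist_zero_right] at hx hx'
      linarith
  have out : ∀ x y, x ∈ closedBall (0 : E) R → y ∉ closedBall (0 : E) R →
      dist ((ball 0 R).indicator h x) ((ball 0 R).indicator h y) ≤ K * dist x y := by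
    intro x y hx hy
    have hyb : y ∉ ball (0 : E) R := fun h ↦ hy (ball_subset_closedBall h)
    have hc : ContinuousOn (fun t : ℝ ↦ ‖AffineMap.lineMap x y t‖) (Icc 0 1) := by
      have : Continuous (fun t : ℝ ↦ AffineMap.lineMap x y t) := AffineMap.lineMap_continuous
      exact this.norm.continuousOn
    have hR : R ∈ Icc ‖AffineMap.lineMap (k := ℝ) x y (0 : ℝ)‖
        ‖AffineMap.lineMap (k := ℝ) x y (1 : ℝ)‖ := by
      simp only [mem_closedBall, dist_zero_right, not_le] at hx hy
      simp [hx, hy.le]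
    obtain ⟨t, ht, htR⟩ := intermediate_value_Icc zero_le_one hc hR
    set z := AffineMap.lineMap x y t
    have hz : z ∈ closedBall (0 : E) R := by simp only [mem_closedBall, dist_zero_right]; exact htR.le
    have hd : dist x z ≤ dist x y := by
      rw [dist_left_lineMap, Real.norm_of_nonneg ht.1]
      exact mul_le_of_le_one_left dist_nonneg ht.2
    calc dist ((ball 0 R).indicator h x) ((ball 0 R).indicator h y)
        = dist (h x) (h z) := by rw [eq_on x hx, indicator_of_notMem hyb, h0 z htR]
      _ ≤ K * dist x z := hK.dist_le_mul x hx z hz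
      _ ≤ K * dist x y := by gcongr
  refine LipschitzWith.of_dist_le_mul fun x y ↦ ?_
  by_cases hx : x ∈ closedBall (0 : E) R <;> by_cases hy : y ∈ closedBall (0 : E) R
  · rw [eq_on x hx, eq_on y hy]
    exact hK.dist_le_mul x hx y hy
  · exact out x y hx hy
  · rw [dist_comm, dist_comm x y]
    exact out y x hy hx
  · rw [indicator_of_notMem fun h ↦ hx (ball_subset_closedBall h),
      indicator_of_notMem fun h ↦ hy (ball_subset_closedBall h), dist_self]
    positivity

theorem det_one_add_pos (A : E →L[ℝ] E) (hA : ‖A‖ < 1) : 0 < (1 + A).det := by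
  by_contra! hneg
  have hc : ContinuousOn (fun s : ℝ ↦ (1 + s • A).det) (Icc 0 1) :=
    (ContinuousLinearMap.continuous_det.comp (by fun_prop)).continuousOn
  obtain ⟨s, hs, hdet⟩ := intermediate_value_Icc' zero_le_one hc
    (show (0 : ℝ) ∈ Icc _ _ by
      simp only [one_smul, zero_smul, add_zero]
      exact ⟨hneg, by simp [ContinuousLinearMap.det]⟩)
  have hker := LinearMap.bot_lt_ker_of_det_eq_zero (f := ((1 + s • A : E →L[ℝ] E) : E →ₗ[ℝ] E)) hdet
  obtain ⟨x, hx, hx0⟩ := (Submodule.ne_bot_iff _).1 hker.ne'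
  have hx1 : x = -(s • A x) := by
    have : x + s • A x = 0 := by simpa using hx
    exact eq_neg_of_add_eq_zero_left this
  have hpos : 0 < ‖x‖ := norm_pos_iff.2 hx0
  have : ‖x‖ ≤ ‖A‖ * ‖x‖ := calc
    ‖x‖ = ‖s‖ * ‖A x‖ := by conv_lhs => rw [hx1, norm_neg, norm_smul]
    _ ≤ 1 * ‖A x‖ := by
      gcongr
      rw [Real.norm_of_nonneg hs.1]; exact hs.2
    _ ≤ ‖A‖ * ‖x‖ := by rw [one_mul]; exact A.le_opNorm x
  nlinarith

theorem image_ball_add_of_lipschitz {g : E → E} {R : ℝ} {c : NNReal} (hc : c < 1)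
    (hg : LipschitzWith c g) (h0 : ∀ x ∉ ball (0 : E) R, g x = 0) :
    Function.Injective (fun x ↦ x + g x) ∧ (fun x ↦ x + g x) '' ball 0 R = ball 0 R := by
  set F : E → E := fun x ↦ x + g x
  have hF : ApproximatesLinearOn F ((ContinuousLinearEquiv.refl ℝ E : E ≃L[ℝ] E) : E →L[ℝ] E)
      univ c := by
    rw [ApproximatesLinearOn.approximatesLinearOn_iff_lipschitzOnWith, lipschitzOnWith_univ]
    convert hg using 1
    ext x
    simp [F]
  have hc' : Subsingleton E ∨
      c < ‖((ContinuousLinearEquiv.refl ℝ E).symm : E →L[ℝ] E)‖₊⁻¹ := by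
    rcases subsingleton_or_nontrivial E with h | h
    · exact Or.inl h
    · right
      have : ‖((ContinuousLinearEquiv.refl ℝ E).symm : E →L[ℝ] E)‖₊ = 1 := by
        ext; exact ContinuousLinearMap.norm_id
      rw [this, inv_one]; exact hc
  have hsurj : Function.Surjective F := hF.surjective hc'
  have hinj : Function.Injective F := injOn_univ.1 (hF.injOn hc')
  refine ⟨hinj, ?_⟩
  have hid : F '' (ball 0 R)ᶜ = (ball 0 R)ᶜ := by
    rw [image_congr (g := id) (fun x hx ↦ by simp [F, h0 x hx]), image_id]
  rw [image_compl_eq ⟨hinj, hsurj⟩] at hid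
  exact compl_injective hid

variable [MeasurableSpace E] [BorelSpace E]

theorem integrableOn_det_one_add_smul_fderiv {h : E → E} (hh : ContDiff ℝ 1 h) (R t : ℝ) :
    IntegrableOn (fun x ↦ (1 + t • fderiv ℝ h x).det) (ball 0 R) := by
  have hc : Continuous (fun x ↦ (1 + t • fderiv ℝ h x).det) := by
    have := hh.continuous_fderiv one_ne_zero
    exact ContinuousLinearMap.continuous_det.comp (by fun_prop)
  exact (hc.continuousOn.integrableOn_compact (isCompact_closedBall 0 R)).mono_set
    ball_subset_closedBall

theorem exists_forall_integral_det_eq {h : E → E} (hh : ContDiff ℝ 1 h) {R : ℝ}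
    (h0 : ∀ x, ‖x‖ = R → h x = 0) :
    ∃ ε : ℝ, 0 < ε ∧ ∀ t ∈ Ioc 0 ε,
      ∫ x in ball (0 : E) R, (1 + t • fderiv ℝ h x).det = volume.real (ball (0 : E) R) := by
  obtain ⟨K, hK⟩ := (hh.contDiffOn (s := closedBall 0 R)).exists_lipschitzOnWith one_ne_zero
    (convex_closedBall 0 R) (isCompact_closedBall 0 R)
  refine ⟨1 / (K + 1 : ℝ), by positivity, fun t ht ↦ ?_⟩
  have htK : t * K < 1 := by
    have := ht.2
    rw [le_div_iff₀ (by positivity)] at this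
    nlinarith [ht.1]
  have hlip := lipschitzWith_indicator_ball hK h0
  obtain ⟨hinj, himg⟩ := image_ball_add_of_lipschitz (c := t.toNNReal * K)
    (g := fun x ↦ t • (ball 0 R).indicator h x) (R := R) (by
      rw [← NNReal.coe_lt_coe, NNReal.coe_mul, Real.coe_toNNReal t ht.1.le]
      exact htK)
    (LipschitzWith.of_dist_le_mul fun x y ↦ by
      rw [dist_smul₀, Real.norm_of_nonneg ht.1.le, NNReal.coe_mul,
        Real.coe_toNNReal t ht.1.le, mul_assoc]
      exact mul_le_mul_of_nonneg_left (hlip.dist_le_mul x y) ht.1.le)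
    (fun x hx ↦ by simp [indicator_of_notMem hx])
  have heq : EqOn (fun x ↦ x + t • (ball 0 R).indicator h x) (fun x ↦ x + t • h x)
      (ball 0 R) := fun x hx ↦ by simp [indicator_of_mem hx]
  have hd (x : E) : HasFDerivAt (fun x ↦ x + t • h x) (1 + t • fderiv ℝ h x) x :=
    (hasFDerivAt_id x).add ((hh.differentiable one_ne_zero x).hasFDerivAt.const_smul t)
  have key := integral_image_eq_integral_abs_det_fderiv_smul volume
    (measurableSet_ball (x := (0 : E)) (ε := R)) (fun x _ ↦ (hd x).hasFDerivWithinAt)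
    (hinj.injOn.congr heq) (fun _ ↦ (1 : ℝ))
  rw [← image_congr heq, himg] at key
  simp only [smul_eq_mul, mul_one, integral_const, MeasurableSet.univ, measureReal_restrict_apply,
    univ_inter] at key
  rw [key]
  refine setIntegral_congr_fun measurableSet_ball fun x hx ↦ (abs_of_pos ?_).symm
  refine det_one_add_pos _ ?_
  rw [norm_smul, Real.norm_of_nonneg ht.1.le]
  refine lt_of_le_of_lt (mul_le_mul_of_nonneg_left ?_ ht.1.le) htK
  exact norm_fderiv_le_of_lipschitzOn ℝ (closedBall_mem_nhds_of_mem hx) hK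

theorem integral_det_one_add_fderiv {h : E → E} (hh : ContDiff ℝ 1 h) {R : ℝ}
    (h0 : ∀ x, ‖x‖ = R → h x = 0) :
    ∫ x in ball (0 : E) R, (1 + fderiv ℝ h x).det = volume.real (ball (0 : E) R) := by
  obtain ⟨ε, hε, H⟩ := exists_forall_integral_det_eq hh h0
  let v : ℕ → ℝ := fun i ↦ ε / (i + 1)
  have hv : Function.Injective v := fun i j hij ↦ by
    have : (i : ℝ) + 1 = j + 1 := by
      simpa [v, div_eq_mul_inv, hε.ne'] using hij
    exact_mod_cast add_right_cancel this
  have hv' (i : ℕ) : v i ∈ Ioc 0 ε :=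
    ⟨by positivity, div_le_self hε.le (by linarith [(Nat.cast_nonneg i : (0 : ℝ) ≤ i)])⟩
  simp_rw [fun x ↦ det_one_add_eq_sum_lagrange (fderiv ℝ h x) v hv.injOn]
  rw [integral_finsetSum _ fun i _ ↦ (integrableOn_det_one_add_smul_fderiv hh R (v i)).const_mul _]
  simp_rw [integral_const_mul, fun i ↦ H (v i) (hv' i)]
  rw [← Finset.sum_mul, ← Polynomial.eval_finsetSum, Lagrange.sum_basis hv.injOn (by simp)]
  simp

omit [MeasurableSpace E] [BorelSpace E] in
theorem not_exists_contDiff_retraction_sphere {R : ℝ} (hR : 0 < R) (G : E → E)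
    (hG : ContDiff ℝ 1 G) (hn : ∀ x, ‖G x‖ = R) : ∃ x, ‖x‖ = R ∧ G x ≠ x := by
  borelize E
  by_contra! hid
  have hint := integral_det_one_add_fderiv (hG.sub contDiff_id)
    (fun x hx ↦ show G x - x = 0 by rw [hid x hx, sub_self])
  have hdet (x : E) : (1 + fderiv ℝ (fun x ↦ G x - id x) x).det = 0 := by
    have hGx := (hG.differentiable one_ne_zero x).hasFDerivAt
    have : (1 + fderiv ℝ (fun x ↦ G x - id x) x) = fderiv ℝ G x := by
      have hsub : HasFDerivAt (fun x ↦ G x - id x) _ x := hGx.sub (hasFDerivAt_id x)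
      rw [hsub.fderiv]
      exact add_sub_cancel _ _
    rw [this]
    by_contra hne
    have hunit : IsUnit ((fderiv ℝ G x : E →L[ℝ] E) : E →ₗ[ℝ] E) :=
      (LinearMap.isUnit_iff_isUnit_det _).2 (isUnit_iff_ne_zero.2 hne)
    obtain ⟨w, hw⟩ := ((Module.End.isUnit_iff _).1 hunit).2 (G x)
    have hconst : (fun y ↦ ‖G y‖ ^ 2) = fun _ ↦ R ^ 2 := by ext y; rw [hn]
    have h2 := hGx.norm_sq
    rw [hconst] at h2
    have h3 := congrArg (fun L : E →L[ℝ] ℝ ↦ L w) (h2.unique (hasFDerivAt_const _ _))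
    have hw' : fderiv ℝ G x w = G x := hw
    simp [hw', hn, hR.ne'] at h3
  have hpos : 0 < volume.real (ball (0 : E) R) :=
    ENNReal.toReal_pos (measure_ball_pos volume 0 hR).ne' measure_ball_lt_top.ne
  simp only [hdet, integral_zero] at hint
  exact hpos.ne hint

end NoRetraction

section Separation

open Metric Set

variable {E : Type*} [NormedAddCommGroup E] [InnerProductSpace ℝ E] [FiniteDimensional ℝ E]

theorem exists_eq_zero_of_eq_id_outside {f : E → E} (hf : Continuous f) {R : ℝ} (hR : 0 < R)
    (hid : ∀ x, R ≤ ‖x‖ → f x = x) : ∃ x, f x = 0 := by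
  by_contra! hne
  obtain ⟨g, hg, hgf, hsupp⟩ := (hf.sub continuous_id).exists_contDiff_approx 1 hf.norm
    fun x ↦ norm_pos_iff.2 (hne x)
  have hF0 (x : E) : x + g x ≠ 0 := by
    intro h
    have h1 := hgf x
    have : dist (g x) (f x - id x) = ‖f x‖ := by
      rw [dist_comm, dist_eq_norm]
      congr 1
      calc f x - x - g x = f x - (x + g x) := by abel
        _ = f x := by rw [h, sub_zero]
    exact h1.ne this
  have hFid (x : E) (hx : ‖x‖ = R) : x + g x = x := by
    have : x ∉ Function.support g := fun h ↦ hsupp h (by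
      change f x - x = 0
      rw [hid x hx.ge, sub_self])
    rw [Function.notMem_support.1 this, add_zero]
  have hF : ContDiff ℝ 1 (fun x ↦ x + g x) := contDiff_id.add hg
  obtain ⟨x, hx, hGx⟩ := not_exists_contDiff_retraction_sphere hR
    (fun x ↦ (R * ‖x + g x‖⁻¹) • (x + g x))
    ((contDiff_const.mul ((hF.norm ℝ hF0).inv fun x ↦ norm_ne_zero_iff.2 (hF0 x))).smul hF)
    (fun x ↦ by
      have := norm_ne_zero_iff.2 (hF0 x)
      rw [norm_smul, norm_mul, norm_inv, norm_norm, Real.norm_of_nonneg hR.le]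
      field_simp)
  exact hGx (by rw [hFid x hx, hx, mul_inv_cancel₀ hR.ne', one_smul])

theorem surjective_of_eq_id_outside {f : E → E} (hf : Continuous f) {R : ℝ}
    (hid : ∀ x, R < ‖x‖ → f x = x) : Function.Surjective f := by
  intro w
  obtain ⟨x, hx⟩ := exists_eq_zero_of_eq_id_outside (f := fun x ↦ f (x + w) - w)
    (R := |R| + ‖w‖ + 1) (by fun_prop) (by positivity) (fun x hx ↦ by
      rw [hid, add_sub_cancel_right]
      have h1 : ‖x‖ - ‖w‖ ≤ ‖x + w‖ := by simpa using norm_sub_norm_le x (-w)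
      linarith [le_abs_self R])
  exact ⟨x + w, sub_eq_zero.1 hx⟩

omit [FiniteDimensional ℝ E] in
theorem isPreconnected_setOf_norm_mem (hE : 1 < Module.rank ℝ E) {I : Set ℝ}
    (hI : IsPreconnected I) (hpos : ∀ t ∈ I, 0 < t) : IsPreconnected {x : E | ‖x‖ ∈ I} := by
  have : {x : E | ‖x‖ ∈ I} = (fun p : ℝ × E ↦ p.1 • p.2) '' (I ×ˢ sphere 0 1) := by
    ext x
    constructor
    · intro hx
      have hx0 := hpos _ hx
      exact ⟨(‖x‖, ‖x‖⁻¹ • x), ⟨hx, by simp [norm_smul, hx0.ne']⟩, by simp [hx0.ne', smul_smul]⟩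
    · rintro ⟨⟨t, y⟩, ⟨ht, hy⟩, rfl⟩
      have hy1 : ‖y‖ = 1 := by simpa using hy
      simpa [norm_smul, hy1, abs_of_pos (hpos t ht)] using ht
  rw [this]
  exact (hI.prod (isPreconnected_sphere hE 0 1)).image _ (by fun_prop)

theorem isPreconnected_compl_of_retract (hE : 1 < Module.rank ℝ E) {K : Set E} (hK : IsCompact K)
    {r : E → E} (hr : Continuous r) (hrK : ∀ x, r x ∈ K) (hid : ∀ x ∈ K, r x = x) :
    IsPreconnected Kᶜ := by
  obtain ⟨R, hR, hKR⟩ := hK.isBounded.subset_closedBall_lt 0 0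
  let T : Set E := {x | ‖x‖ ∈ Ioi R}
  have hT : IsPreconnected T :=
    isPreconnected_setOf_norm_mem hE isPreconnected_Ioi fun t ht ↦ hR.trans ht
  have hTK : T ⊆ Kᶜ := fun x hx hxK ↦ not_le.2 hx (by simpa using hKR hxK)
  have meets (w : E) (hw : w ∈ Kᶜ) : ∃ x ∈ T, x ∈ connectedComponentIn Kᶜ w := by
    by_contra! hW
    set W := connectedComponentIn Kᶜ w
    have hWo : IsOpen W := hK.isClosed.isOpen_compl.connectedComponentIn
    have hfr : ∀ x ∈ frontier W, x ∈ K := by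
      intro x hx
      by_contra hxK
      have hpre : IsPreconnected (insert x W) :=
        isPreconnected_connectedComponentIn.subset_closure (subset_insert _ _)
          (insert_subset hx.1 subset_closure)
      have hsub := hpre.subset_connectedComponentIn
        (mem_insert_of_mem x (mem_connectedComponentIn hw))
        (insert_subset hxK (connectedComponentIn_subset _ _))
      exact hx.2 (hWo.interior_eq.symm ▸ hsub (mem_insert x W))
    classical
    have hf : Continuous (W.piecewise r id) :=
      continuous_piecewise (fun x hx ↦ hid x (hfr x hx)) hr.continuousOn continuousOn_id
    obtain ⟨x, hx⟩ := surjective_of_eq_id_outside hf (R := R)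
      (fun x hx ↦ piecewise_eq_of_notMem _ _ _ (hW x hx)) w
    by_cases hxW : x ∈ W
    · rw [piecewise_eq_of_mem _ _ _ hxW] at hx
      exact hw (hx ▸ hrK x)
    · rw [piecewise_eq_of_notMem _ _ _ hxW] at hx
      exact hxW ((show x = w from hx) ▸ mem_connectedComponentIn hw)
  refine isPreconnected_of_forall_pair fun x hx y hy ↦ ?_
  obtain ⟨a, haT, ha⟩ := meets x hx
  obtain ⟨b, hbT, hb⟩ := meets y hy
  refine ⟨connectedComponentIn Kᶜ x ∪ T ∪ connectedComponentIn Kᶜ y,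
    union_subset (union_subset (connectedComponentIn_subset _ _) hTK)
      (connectedComponentIn_subset _ _),
    Or.inl (Or.inl (mem_connectedComponentIn hx)), Or.inr (mem_connectedComponentIn hy), ?_⟩
  exact (isPreconnected_connectedComponentIn.union a ha haT hT).union b (Or.inr hbT) hb
    isPreconnected_connectedComponentIn

theorem isPreconnected_compl_image_closedBall (hE : 1 < Module.rank ℝ E) {ψ : E → E}
    (hc : Continuous ψ) (hinj : Function.Injective ψ) {r : ℝ} (hr : 0 < r) :
    IsPreconnected (ψ '' closedBall 0 r)ᶜ := by
  have : TietzeExtension (closedBall (0 : E) r) := Metric.instTietzeExtensionClosedBall ℝ 0 hr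
  have : CompactSpace (closedBall (0 : E) r) :=
    isCompact_iff_compactSpace.1 (isCompact_closedBall 0 r)
  have hemb : Topology.IsClosedEmbedding (fun x : closedBall (0 : E) r ↦ ψ x) :=
    (hc.comp continuous_subtype_val).isClosedEmbedding
      (hinj.comp Subtype.val_injective)
  obtain ⟨g, hg⟩ := ContinuousMap.exists_extension hemb (ContinuousMap.id _)
  refine isPreconnected_compl_of_retract hE ((isCompact_closedBall 0 r).image hc)
    (r := fun x ↦ ψ (g x)) (by fun_prop) (fun x ↦ mem_image_of_mem ψ (g x).2) ?_
  rintro _ ⟨x, hx, rfl⟩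
  have := congrArg (fun F : C(closedBall (0 : E) r, closedBall (0 : E) r) ↦ F ⟨x, hx⟩) hg
  have h2 : g (ψ x) = ⟨x, hx⟩ := this
  simp [h2]

theorem IsPreconnected.diff_closedBall (hE : 1 < Module.rank ℝ E) {U : Set E}
    (hU : IsPreconnected U) (hUo : IsOpen U) {r : ℝ} (hr : 0 ≤ r) (hrU : closedBall 0 r ⊆ U) :
    IsPreconnected (U \ closedBall 0 r) := by
  obtain ⟨δ, hδ, hδU⟩ := (isCompact_closedBall (0 : E) r).exists_thickening_subset_open hUo hrU
  rw [thickening_closedBall hδ hr, add_comm] at hδU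
  have hA : IsPreconnected {x : E | ‖x‖ ∈ Ioo r (r + δ)} :=
    isPreconnected_setOf_norm_mem hE isPreconnected_Ioo fun t ht ↦ hr.trans_lt ht.1
  have hAU : {x : E | ‖x‖ ∈ Ioo r (r + δ)} ⊆ U \ closedBall 0 r := fun x hx ↦
    ⟨hδU (by simpa using hx.2), by simpa using hx.1⟩
  have hmem (x : E) (hx : x ∈ ball (0 : E) (r + δ)) (hx' : x ∉ closedBall (0 : E) r) :
      x ∈ {x : E | ‖x‖ ∈ Ioo r (r + δ)} := by
    simp only [mem_ball, mem_closedBall, dist_zero_right, not_le] at hx hx'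
    exact ⟨hx', hx⟩
  have main : ∀ u v : Set E, IsOpen u → IsOpen v → U \ closedBall 0 r ⊆ u ∪ v →
      U \ closedBall 0 r ∩ (u ∩ v) = ∅ → {x : E | ‖x‖ ∈ Ioo r (r + δ)} ⊆ u →
      U \ closedBall 0 r ⊆ u := by
    intro u v hu hv huv hd hAu
    have h := isPreconnected_iff_subset_of_disjoint.1 hU (u ∪ ball 0 (r + δ))
      (v \ closedBall 0 r) (hu.union isOpen_ball) (hv.sdiff isClosed_closedBall) ?_ ?_
    · rcases h with h | h
      · intro x hx
        exact (h hx.1).elim id fun hb ↦ hAu (hmem x hb hx.2)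
      · have h0 : (0 : E) ∈ closedBall (0 : E) r := mem_closedBall_self hr
        exact absurd h0 (h (hrU h0)).2
    · intro x hx
      by_cases hxr : x ∈ closedBall (0 : E) r
      · exact Or.inl (Or.inr (closedBall_subset_ball (by linarith) hxr))
      · exact (huv ⟨hx, hxr⟩).imp Or.inl fun h ↦ ⟨h, hxr⟩
    · refine eq_empty_of_forall_notMem fun x ⟨hxU, hxu, hxv, hxr⟩ ↦ ?_
      have : x ∈ u := hxu.elim id fun hb ↦ hAu (hmem x hb hxr)
      exact (eq_empty_iff_forall_notMem.1 hd) x ⟨⟨hxU, hxr⟩, this, hxv⟩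
  refine isPreconnected_iff_subset_of_disjoint.2 fun u v hu hv huv hd ↦ ?_
  rcases isPreconnected_iff_subset_of_disjoint.1 hA u v hu hv (hAU.trans huv)
    (subset_eq_empty (inter_subset_inter_left _ hAU) hd) with h | h
  · exact Or.inl (main u v hu hv huv hd h)
  · exact Or.inr (main v u hv hu (by rwa [union_comm]) (by rwa [inter_comm v u]) h)

omit [FiniteDimensional ℝ E] in
theorem mem_closure_compl_of_norm_eq {f : E → E} (hf : Continuous f) (hinj : Function.Injective f)
    {S : Set E} (hS : IsClosed S) {r : ℝ} (hr : 0 < r) {x : E} (hx : ‖x‖ = r) (hxS : f x ∉ S) :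
    f x ∈ closure (f '' closedBall 0 r ∪ S)ᶜ := by
  have hc : Continuous (fun t : ℝ ↦ f (t • x)) := by fun_prop
  have ht : Filter.Tendsto (fun t : ℝ ↦ f (t • x)) (nhdsWithin 1 (Ioi 1)) (nhds (f x)) := by
    have := hc.tendsto 1
    rw [one_smul] at this
    exact this.mono_left nhdsWithin_le_nhds
  refine mem_closure_of_tendsto ht ?_
  filter_upwards [ht (hS.isOpen_compl.mem_nhds hxS), self_mem_nhdsWithin] with t htS ht1
  rintro (⟨y, hy, hyt⟩ | h)
  · rw [hinj hyt] at hy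
    simp only [mem_closedBall, dist_zero_right, norm_smul, hx, Real.norm_eq_abs] at hy
    have : t ≤ |t| := le_abs_self t
    have ht1' : (1 : ℝ) < t := ht1
    nlinarith
  · exact htS h

end Separation

/-- for `d ≥ 2`, `ψ : ℝ^d → ℝ^d` continuous and injective, and `n ≥ 1` such that
`ψ(B[0,n]) ∩ B[0,n] = ∅`, the set `ℝ^d \ (ψ(B(0,n)) ∪ B(0,n))` is connected. -/
theorem stmt11 (d : ℕ) (hd : 2 ≤ d)
    (ψ : EuclideanSpace ℝ (Fin d) → EuclideanSpace ℝ (Fin d))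
    (hc : Continuous ψ) (hinj : Function.Injective ψ)
    (n : ℕ) (hn : 1 ≤ n)
    (hdisj : (ψ '' Metric.closedBall 0 (n : ℝ)) ∩ Metric.closedBall 0 (n : ℝ) = ∅) :
    IsConnected ((ψ '' Metric.ball 0 (n : ℝ) ∪ Metric.ball 0 (n : ℝ))ᶜ) := by
  have hE : 1 < Module.rank ℝ (EuclideanSpace ℝ (Fin d)) := by
    rw [← Module.finrank_eq_rank, finrank_euclideanSpace_fin]
    exact_mod_cast hd
  have hn0 : (0 : ℝ) < n := by exact_mod_cast hn
  set D := Metric.closedBall (0 : EuclideanSpace ℝ (Fin d)) (n : ℝ)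
  have hKc : IsClosed (ψ '' D) := ((isCompact_closedBall 0 (n : ℝ)).image hc).isClosed
  have hnot (x : EuclideanSpace ℝ (Fin d)) (hx : x ∈ ψ '' D) (hx' : x ∈ D) : False :=
    (Set.eq_empty_iff_forall_notMem.1 hdisj) x ⟨hx, hx'⟩
  have hY : IsPreconnected (ψ '' D ∪ D)ᶜ := by
    rw [Set.compl_union, ← Set.sdiff_eq]
    exact (isPreconnected_compl_image_closedBall hE hc hinj hn0).diff_closedBall hE
      hKc.isOpen_compl hn0.le fun x hx hx' ↦ hnot x hx' hx
  have hball : Metric.ball (0 : EuclideanSpace ℝ (Fin d)) n ⊆ D := Metric.ball_subset_closedBall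
  have hnorm {x : EuclideanSpace ℝ (Fin d)} (hx : x ∈ D) (hx' : x ∉ Metric.ball 0 (n : ℝ)) :
      ‖x‖ = n := by
    simp only [D, Metric.mem_closedBall, Metric.mem_ball, dist_zero_right, not_lt] at hx hx'
    exact le_antisymm hx hx'
  refine ⟨?_, hY.subset_closure
    (Set.compl_subset_compl.2 (Set.union_subset_union (Set.image_mono hball) hball)) ?_⟩
  · obtain ⟨x, hx⟩ := (isConnected_sphere hE (0 : EuclideanSpace ℝ (Fin d)) hn0.le).nonempty
    refine ⟨x, ?_⟩
    rintro (h | h)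
    · exact hnot x (Set.image_mono hball h) (Metric.sphere_subset_closedBall hx)
    · exact (Metric.mem_ball.1 h).ne hx
  · intro x hx
    rw [Set.mem_compl_iff, Set.mem_union, not_or] at hx
    by_cases hxK : x ∈ ψ '' D
    · obtain ⟨y, hy, rfl⟩ := hxK
      exact mem_closure_compl_of_norm_eq hc hinj Metric.isClosed_closedBall hn0
        (hnorm hy fun h ↦ hx.1 ⟨y, h, rfl⟩) fun h ↦ hnot _ ⟨y, hy, rfl⟩ h
    by_cases hxD : x ∈ D
    · have := mem_closure_compl_of_norm_eq continuous_id Function.injective_id hKc hn0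
        (hnorm hxD hx.2) hxK
      rwa [Set.image_id, Set.union_comm] at this
    · exact subset_closure (by simp [hxK, hxD])
end
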